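/- Let K be an algebraically closed field of characteristic 0 and let f be a multilinear polynomial of degree at most 3, i.e., f = Σ_{σ ∈ S_d} c_σ X_{σ(1)} ⋯ X_{σ(d)} with d ≤ 3 and coefficients c_σ ∈ K. Then for every n ≥ 2, the image f(M_n(K)) = {f(a₁,…,a_d) | aᵢ ∈ M_n(K)} is a K-linear subspace of M_n(K). -/

import Mathlib

/-- Evaluation of the multilinear (noncommutative) polynomial
`∑ σ ∈ S_d, c σ • X_{σ(1)} ⋯ X_{σ(d)}` at the tuple `a`. -/
noncomputable def mlinEval {K : Type*} [CommSemiring K] {A : Type*} [Semiring A]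
    [Algebra K A] {d : ℕ} (c : Equiv.Perm (Fin d) → K) (a : Fin d → A) : A :=
  ∑ σ : Equiv.Perm (Fin d), c σ • (List.ofFn fun i => a (σ i)).prod

section LKThree
open Matrix

theorem lk_conj_mk {ι K : Type*} [Fintype ι] [DecidableEq ι] [Field K] {A B P Q : Matrix ι ι K}
    (h1 : P * Q = 1) (h2 : Q * P = 1) (h : B = P * A * Q) : IsConj A B := by
  refine ⟨⟨P, Q, h1, h2⟩, ?_⟩
  show P * A = B * P
  rw [h, Matrix.mul_assoc (P * A), h2, Matrix.mul_one]

theorem lk_conj_get {ι K : Type*} [Fintype ι] [DecidableEq ι] [Field K] {A B : Matrix ι ι K}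
    (h : IsConj A B) : ∃ P Q : Matrix ι ι K, P * Q = 1 ∧ Q * P = 1 ∧ B = P * A * Q := by
  obtain ⟨c, hc⟩ := h
  refine ⟨c.1, c.2, c.3, c.4, ?_⟩
  have h' : c.1 * A = B * c.1 := hc
  have h3 : c.1 * c.2 = 1 := c.3
  rw [h', Matrix.mul_assoc, h3, Matrix.mul_one]

theorem lk_conj_trace {ι K : Type*} [Fintype ι] [DecidableEq ι] [Field K] {A B : Matrix ι ι K}
    (h : IsConj A B) : A.trace = B.trace := by
  obtain ⟨P, Q, h1, h2, rfl⟩ := lk_conj_get h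
  rw [Matrix.trace_mul_comm, ← Matrix.mul_assoc, h2, Matrix.one_mul]

theorem lk_conj_scalar {ι K : Type*} [Fintype ι] [DecidableEq ι] [Field K] {A B : Matrix ι ι K}
    (h : IsConj A B) (hA : ∀ r : K, A ≠ r • 1) : ∀ r : K, B ≠ r • 1 := by
  intro r hr
  obtain ⟨P, Q, h1, h2, rfl⟩ := lk_conj_get h
  apply hA r
  have : Q * (P * A * Q) * P = A := by
    calc Q * (P * A * Q) * P = (Q * P) * A * (Q * P) := by noncomm_ring
      _ = A := by rw [h2]; simp
  rw [← this, hr]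
  simp [h2]

/-- conjugation by a permutation -/
theorem lk_conj_perm {ι K : Type*} [Fintype ι] [DecidableEq ι] [Field K] (A : Matrix ι ι K)
    (e : Equiv.Perm ι) : IsConj A (A.submatrix e e) := by
  refine lk_conj_mk (P := (1 : Matrix ι ι K).submatrix e id)
    (Q := (1 : Matrix ι ι K).submatrix id e) ?_ ?_ ?_
  · ext i j
    simp [Matrix.mul_apply, Matrix.one_apply]
  · rw [Matrix.submatrix_mul_equiv (e₂ := e)]
    simp
  · ext i j
    simp [Matrix.mul_apply, Matrix.one_apply]

/-- conjugation by a transvection -/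
theorem lk_conj_shear {ι K : Type*} [Fintype ι] [DecidableEq ι] [Field K] (A : Matrix ι ι K)
    (i j : ι) (hij : i ≠ j) (t : K) :
    IsConj A ((1 - single j i t) * A * (1 + single j i t)) := by
  have h : single j i t * single j i t = (0 : Matrix ι ι K) := by
    simp [Matrix.single_mul_single_of_ne, hij]
  refine lk_conj_mk ?_ ?_ rfl
  · calc (1 - single j i t) * (1 + single j i t) = 1 - single j i t * single j i t := by noncomm_ring
      _ = 1 := by rw [h, sub_zero]
  · calc (1 + single j i t) * (1 - single j i t) = 1 - single j i t * single j i t := by noncomm_ring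
      _ = 1 := by rw [h, sub_zero]

theorem lk_shear_apply {ι K : Type*} [Fintype ι] [DecidableEq ι] [Field K] (A : Matrix ι ι K)
    (i j : ι) (t : K) (a b : ι) :
    ((1 - single j i t) * A * (1 + single j i t)) a b =
      A a b + (if b = i then A a j * t else 0) - (if a = j then t * A i b else 0)
        - (if a = j ∧ b = i then t * A i j * t else 0) := by
  have e : (1 - single j i t) * A * (1 + single j i t)
    = A + A * single j i t - single j i t * A - single j i t * A * single j i t := by noncomm_ring
  rw [e]
  simp only [Matrix.sub_apply, Matrix.add_apply]
  congr 1
  · congr 1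
    · congr 1
      split_ifs with h
      · subst h; simp
      · simp [h]
    · split_ifs with h
      · subst h; simp
      · simp [h]
  · rw [Matrix.mul_assoc]
    by_cases h : a = j
    · subst h
      by_cases h2 : b = i
      · subst h2; simp [mul_assoc]
      · simp [h2]
    · simp [h]

theorem lk_offdiag {ι K : Type*} [Fintype ι] [DecidableEq ι] [Field K] (A : Matrix ι ι K)
    (hA : ∀ r : K, A ≠ r • 1) : ∃ B, IsConj A B ∧ ∃ i j, i ≠ j ∧ B i j ≠ 0 := by
  by_cases h : ∃ i j, i ≠ j ∧ A i j ≠ 0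
  · exact ⟨A, IsConj.refl A, h⟩
  push Not at h
  obtain ⟨i, j, hij, hd⟩ : ∃ i j, i ≠ j ∧ A i i ≠ A j j := by
    by_contra hc
    push Not at hc
    by_cases hne : Nonempty ι
    · obtain ⟨k⟩ := hne
      apply hA (A k k)
      ext i j
      by_cases hij : i = j
      · subst hij
        by_cases hik : i = k
        · subst hik; simp
        · simpa using hc i k hik
      · simp [hij, h i j hij]
    · apply hA 0
      ext i j
      exact (hne ⟨i⟩).elim
  refine ⟨_, lk_conj_shear A i j hij 1, j, i, hij.symm, ?_⟩
  rw [lk_shear_apply]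
  simp [h j i hij.symm, h i j hij]
  intro hh
  apply hd
  rw [sub_eq_zero] at hh
  exact hh.symm

theorem lk_perm {ι : Type*} [DecidableEq ι] {i j i' j' : ι} (h : i ≠ j) (h' : i' ≠ j') :
    ∃ e : Equiv.Perm ι, e i = i' ∧ e j = j' := by
  refine ⟨(Equiv.swap i i').trans (Equiv.swap (Equiv.swap i i' j) j'), ?_, ?_⟩
  · simp only [Equiv.trans_apply, Equiv.swap_apply_left]
    apply Equiv.swap_apply_of_ne_of_ne
    · intro hh
      apply h
      apply (Equiv.swap i i').injective
      simpa using hh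
    · exact h'
  · simp

theorem lk_L1 {ι K : Type*} [Fintype ι] [DecidableEq ι] [Field K] (A : Matrix ι ι K)
    (hA : ∀ r : K, A ≠ r • 1) (i j : ι) (hij : i ≠ j) (δ : K) :
    ∃ B, IsConj A B ∧ B i i = δ ∧ B i j ≠ 0 := by
  obtain ⟨B, hAB, i', j', hij', hB⟩ := lk_offdiag A hA
  obtain ⟨e, he1, he2⟩ := lk_perm hij hij'
  have hBC := lk_conj_perm B e
  set C := B.submatrix e e with hC
  have hC' : C i j ≠ 0 := by simpa [hC, he1, he2] using hB
  refine ⟨_, (hAB.trans hBC).trans (lk_conj_shear C i j hij ((δ - C i i) / C i j)), ?_, ?_⟩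
  · rw [lk_shear_apply]
    simp [hij]
    field_simp
    ring
  · rw [lk_shear_apply]
    simp [hij, hij.symm, hC']

theorem lk_step {ι K : Type*} [Fintype ι] [DecidableEq ι] [Field K]
    (B : Matrix (ι ⊕ Fin 1) (ι ⊕ Fin 1) K) (j k : ι) (hjk : j ≠ k)
    (hB : B (Sum.inr 0) (Sum.inl j) ≠ 0) :
    ∃ C, IsConj B C ∧ C (Sum.inr 0) (Sum.inr 0) = B (Sum.inr 0) (Sum.inr 0) ∧
      ∀ r : K, C.toBlocks₁₁ ≠ r • 1 := by
  by_cases h : ∀ r : K, B.toBlocks₁₁ ≠ r • 1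
  · exact ⟨B, IsConj.refl B, rfl, h⟩
  push Not at h
  obtain ⟨r, hr⟩ := h
  set R := B.toBlocks₂₁ with hR
  have hRj : R 0 j ≠ 0 := hB
  let w : Matrix ι (Fin 1) K :=
    Matrix.of fun a _ => if a = j then R 0 k else if a = k then - R 0 j else 0
  have hRw : R * w = 0 := by
    ext a b
    have ha : a = 0 := Subsingleton.elim _ _
    subst ha
    simp only [Matrix.mul_apply, w, Matrix.zero_apply, Matrix.of_apply]
    rw [Finset.sum_eq_add j k hjk]
    · simp [hjk.symm]; ring
    · intro c _ hc; simp [hc.1, hc.2]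
    · simp
    · simp
  refine ⟨fromBlocks 1 w 0 1 * B * fromBlocks 1 (-w) 0 1, lk_conj_mk ?_ ?_ rfl, ?_, ?_⟩
  · simp [fromBlocks_multiply]
  · simp [fromBlocks_multiply]
  · have e : B = fromBlocks B.toBlocks₁₁ B.toBlocks₁₂ R B.toBlocks₂₂ := (fromBlocks_toBlocks B).symm
    rw [e]
    simp [fromBlocks_multiply, hRw]
  · have e : B = fromBlocks B.toBlocks₁₁ B.toBlocks₁₂ R B.toBlocks₂₂ := (fromBlocks_toBlocks B).symm
    intro s hs
    rw [e] at hs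
    simp only [fromBlocks_multiply, toBlocks_fromBlocks₁₁, hr] at hs
    have := congrFun (congrFun hs k) j
    simp [Matrix.mul_apply, w, hjk.symm, hRj] at this

theorem lk_block {ι κ K : Type*} [Fintype ι] [DecidableEq ι] [Fintype κ] [DecidableEq κ] [Field K]
    (C : Matrix (ι ⊕ κ) (ι ⊕ κ) K) (E : Matrix ι ι K) (h : IsConj C.toBlocks₁₁ E) :
    ∃ D, IsConj C D ∧ D.toBlocks₁₁ = E ∧ D.toBlocks₂₂ = C.toBlocks₂₂ := by
  obtain ⟨P, Q, h1, h2, rfl⟩ := lk_conj_get h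
  have e : C = fromBlocks C.toBlocks₁₁ C.toBlocks₁₂ C.toBlocks₂₁ C.toBlocks₂₂ :=
    (fromBlocks_toBlocks C).symm
  refine ⟨fromBlocks P 0 0 1 * C * fromBlocks Q 0 0 1, lk_conj_mk ?_ ?_ rfl, ?_, ?_⟩
  · simp [fromBlocks_multiply, h1]
  · simp [fromBlocks_multiply, h2]
  · conv_lhs => rw [e]
    simp [fromBlocks_multiply]
  · conv_lhs => rw [e]
    simp [fromBlocks_multiply]

theorem lk_fillmore {K : Type*} [Field K] (m : ℕ) :
    ∀ (A : Matrix (Fin (m + 2)) (Fin (m + 2)) K) (_ : ∀ r : K, A ≠ r • 1)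
      (d : Fin (m + 2) → K) (_ : ∑ i, d i = A.trace),
      ∃ B, IsConj A B ∧ (∀ i, B i i = d i) ∧ B 1 0 ≠ 0 := by
  induction m with
  | zero =>
    intro A hA d hd
    obtain ⟨B, hAB, h1, h2⟩ := lk_L1 A hA 1 0 (by simp) (d 1)
    refine ⟨B, hAB, ?_, h2⟩
    have ht := lk_conj_trace hAB
    rw [← hd] at ht
    simp only [Matrix.trace, Matrix.diag, Fin.sum_univ_two, Nat.reduceAdd] at ht
    intro i
    fin_cases i
    · show B 0 0 = d 0
      rw [h1] at ht
      exact (add_right_cancel ht).symm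
    · exact h1
  | succ m ih =>
    intro A hA d hd
    obtain ⟨B, hAB, hl, h0⟩ := lk_L1 A hA (Fin.last _) 0 (by simp [Fin.ext_iff]) (d (Fin.last _))
    let φ : Fin (m + 2) ⊕ Fin 1 ≃ Fin (m + 1 + 2) := finSumFinEquiv
    have hφl : φ (Sum.inr 0) = Fin.last _ := rfl
    have hφ : ∀ i, φ (Sum.inl i) = Fin.castSucc i := fun i => rfl
    have lift : ∀ {X : Matrix (Fin (m + 2) ⊕ Fin 1) (Fin (m + 2) ⊕ Fin 1) K},
        IsConj (B.submatrix φ φ) X → IsConj B (X.submatrix φ.symm φ.symm) := by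
      intro X h
      have := (Matrix.reindexAlgEquiv K K φ).toMonoidHom.map_isConj h
      simpa [Matrix.coe_reindexAlgEquiv] using this
    obtain ⟨C, hBC, hCl, hCs⟩ := lk_step (B.submatrix φ φ) 0 1 (by simp) (by
      simpa [hφl, hφ] using h0)
    have hCl' : C (Sum.inr 0) (Sum.inr 0) = d (Fin.last _) := by
      rw [hCl]; simpa [hφl] using hl
    have htr : C.trace = A.trace := by
      rw [← lk_conj_trace hBC, lk_conj_trace hAB]
      exact Equiv.sum_comp φ (fun i => B i i)
    obtain ⟨E, hE, hEd, hE0⟩ := ih C.toBlocks₁₁ hCs (fun i => d i.castSucc) (by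
      rw [← hd, Fin.sum_univ_castSucc] at htr
      simp only [Matrix.trace, Fintype.sum_sum_type, Matrix.diag, Fin.sum_univ_one,
        Fin.isValue] at htr ⊢
      rw [hCl'] at htr
      exact (add_right_cancel htr).symm)
    obtain ⟨D, hCD, hD1, hD2⟩ := lk_block C E hE
    refine ⟨D.submatrix φ.symm φ.symm, hAB.trans (lift (hBC.trans hCD)), ?_, ?_⟩
    · intro i
      obtain ⟨k, rfl⟩ := φ.surjective i
      rcases k with k | k
      · have := hEd k
        rw [← hD1] at this
        rw [Matrix.submatrix_apply, Equiv.symm_apply_apply]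
        exact this
      · have hk : k = 0 := Subsingleton.elim _ _
        subst hk
        have := congrFun (congrFun hD2 0) 0
        simp only [toBlocks₂₂, of_apply] at this
        rw [Matrix.submatrix_apply, Equiv.symm_apply_apply, this, hCl', hφl]
    · rw [← hD1] at hE0
      have e1 : φ.symm 1 = Sum.inl 1 := by rw [Equiv.symm_apply_eq]; rfl
      have e0 : φ.symm 0 = Sum.inl 0 := by rw [Equiv.symm_apply_eq]; rfl
      rw [Matrix.submatrix_apply, e1, e0]
      exact hE0

/-- The general multilinear polynomial of degree three. -/
def lkF {R K : Type*} [Field K] [Ring R] [Algebra K R] (k1 k2 k3 l1 l2 l3 : K) (x y z : R) : R :=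
  k1 • (x * y * z) + k2 • (y * z * x) + k3 • (z * x * y) + l1 • (x * z * y) + l2 • (z * y * x)
    + l3 • (y * x * z)

theorem lkF_rot {R K : Type*} [Field K] [Ring R] [Algebra K R] (k1 k2 k3 l1 l2 l3 : K) (x y z : R) :
    lkF k3 k1 k2 l2 l3 l1 x y z = lkF k1 k2 k3 l1 l2 l3 y z x := by
  unfold lkF; abel

theorem lkF_smul {R K : Type*} [Field K] [Ring R] [Algebra K R] (k1 k2 k3 l1 l2 l3 : K) (x y z : R)
    (r : K) : lkF k1 k2 k3 l1 l2 l3 x y (r • z) = r • lkF k1 k2 k3 l1 l2 l3 x y z := by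
  simp only [lkF, mul_smul_comm, smul_mul_assoc, smul_add, smul_comm r]

theorem lkF_add_mid {R K : Type*} [Field K] [Ring R] [Algebra K R] (k1 k2 k3 l1 l2 l3 : K)
    (x y y' z : R) : lkF k1 k2 k3 l1 l2 l3 x (y + y') z =
      lkF k1 k2 k3 l1 l2 l3 x y z + lkF k1 k2 k3 l1 l2 l3 x y' z := by
  simp only [lkF, mul_add, add_mul, smul_add]; abel

theorem lkF_conj {ι K : Type*} [Fintype ι] [DecidableEq ι] [Field K] (k1 k2 k3 l1 l2 l3 : K)
    {A B : Matrix ι ι K} (h : IsConj A B) (hB : ∃ x y z, B = lkF k1 k2 k3 l1 l2 l3 x y z) :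
    ∃ x y z, A = lkF k1 k2 k3 l1 l2 l3 x y z := by
  obtain ⟨P, Q, h1, h2, h3⟩ := lk_conj_get h.symm
  obtain ⟨x, y, z, rfl⟩ := hB
  refine ⟨P * x * Q, P * y * Q, P * z * Q, ?_⟩
  have key : ∀ a b c : Matrix ι ι K,
      (P * a * Q) * (P * b * Q) * (P * c * Q) = P * (a * b * c) * Q := by
    intro a b c
    calc (P * a * Q) * (P * b * Q) * (P * c * Q)
        = P * a * (Q * P) * b * (Q * P) * c * Q := by simp only [Matrix.mul_assoc]
      _ = P * (a * b * c) * Q := by rw [h2]; simp only [Matrix.mul_one, Matrix.mul_assoc]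
  rw [h3]
  simp only [lkF, key, Matrix.mul_add, Matrix.add_mul, Matrix.mul_smul, Matrix.smul_mul]

theorem lkF_diag {ι K : Type*} [Fintype ι] [DecidableEq ι] [Field K] (k1 k2 k3 l1 l2 l3 : K)
    (d e : ι → K) (z : Matrix ι ι K) (i j : ι) :
    lkF k1 k2 k3 l1 l2 l3 (diagonal d) (diagonal e) z i j =
      (e i * (k1 * d i + k2 * d j + l3 * d i) + e j * (k3 * d j + l1 * d i + l2 * d j)) * z i j := by
  have e3 : (z * diagonal d * diagonal e) i j = z i j * d j * e j := by
    rw [mul_diagonal, mul_diagonal]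
  have e5 : (z * diagonal e * diagonal d) i j = z i j * e j * d j := by
    rw [mul_diagonal, mul_diagonal]
  simp only [lkF, Matrix.add_apply, Matrix.smul_apply, smul_eq_mul, e3, e5]
  simp only [Matrix.mul_assoc, diagonal_mul, mul_diagonal]
  ring

theorem lkF_single {ι K : Type*} [Fintype ι] [DecidableEq ι] [Field K] (k1 k2 k3 l1 l2 l3 : K)
    (d : ι → K) (p q : ι) (s : K) (z : Matrix ι ι K) (i j : ι) :
    lkF k1 k2 k3 l1 l2 l3 (diagonal d) (single p q s) z i j =
      (if i = p then s * z q j * (k1 * d p + k2 * d j + l3 * d q) else 0) +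
      (if j = q then s * z i p * (k3 * d p + l1 * d i + l2 * d q) else 0) := by
  have hL : ∀ w : Matrix ι ι K, (single p q s * w) i j = if i = p then s * w q j else 0 := by
    intro w
    split_ifs with h
    · subst h; simp
    · simp [h]
  have hR : ∀ w : Matrix ι ι K, (w * single p q s) i j = if j = q then w i p * s else 0 := by
    intro w
    split_ifs with h
    · subst h; simp
    · simp [h]
  have e1 : (diagonal d * single p q s * z) i j = if i = p then d p * (s * z q j) else 0 := by
    rw [Matrix.mul_assoc, diagonal_mul, hL]
    split_ifs with h
    · rw [h]
    · simp
  have e2 : (single p q s * z * diagonal d) i j = if i = p then s * z q j * d j else 0 := by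
    rw [mul_diagonal, hL]; split_ifs <;> simp
  have e3 : (z * diagonal d * single p q s) i j = if j = q then z i p * d p * s else 0 := by
    rw [hR, mul_diagonal]
  have e4 : (diagonal d * z * single p q s) i j = if j = q then d i * z i p * s else 0 := by
    rw [hR, diagonal_mul]
  have e5 : (z * single p q s * diagonal d) i j = if j = q then z i p * s * d q else 0 := by
    rw [mul_diagonal, hR]
    split_ifs with h
    · rw [h]
    · simp
  have e6 : (single p q s * diagonal d * z) i j = if i = p then s * (d q * z q j) else 0 := by
    rw [Matrix.mul_assoc, hL, diagonal_mul]
  simp only [lkF, Matrix.add_apply, Matrix.smul_apply, smul_eq_mul, e1, e2, e3, e4, e5, e6]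
  split_ifs <;> ring

/-- Non-scalar matrices are values. -/
theorem lk_nonscalar {K : Type*} [Field K] [CharZero K] (m : ℕ) (k1 k2 k3 l1 l2 l3 : K)
    (hsum : k1 + k2 + k3 + l1 + l2 + l3 = 0) (hγ : k1 + k2 + k3 ≠ 0) (hκ : k1 + k2 + l3 ≠ 0)
    (A : Matrix (Fin (m + 2)) (Fin (m + 2)) K) (hA : ∀ r : K, A ≠ r • 1) :
    ∃ x y z, A = lkF k1 k2 k3 l1 l2 l3 x y z := by
  set γ := k1 + k2 + k3 with hγd
  set κ := k1 + k2 + l3 with hκd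
  classical
  obtain ⟨ε, hε⟩ := Infinite.exists_notMem_finset ({0, κ / l1, -κ / k2} : Finset K)
  simp only [Finset.mem_insert, Finset.mem_singleton, not_or] at hε
  obtain ⟨hε0, hε1, hε2⟩ := hε
  have hl1 : -κ + l1 * ε ≠ 0 := by
    intro h
    by_cases h0 : l1 = 0
    · rw [h0] at h; apply hκ; linear_combination -h
    · apply hε1; field_simp; linear_combination h
  have hk2 : κ + k2 * ε ≠ 0 := by
    intro h
    by_cases h0 : k2 = 0
    · rw [h0] at h; apply hκ; linear_combination h
    · apply hε2; field_simp; linear_combination h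
  set τ := A.trace with hτ
  set p := κ + (k1 + k2) * ε with hp
  set q := -κ + k3 * ε with hq
  have hpq : p + q = γ * ε := by rw [hp, hq, hγd]; ring
  have hγε : γ * ε ≠ 0 := mul_ne_zero hγ hε0
  obtain ⟨B, hAB, hBd, hB10⟩ := lk_fillmore m A hA
    (fun i => if i = 0 then τ * p / (γ * ε) else if i = 1 then τ * q / (γ * ε) else 0) (by
      rw [Fin.sum_univ_succ, Fin.sum_univ_succ]
      have : ∀ i : Fin m, (i.succ.succ : Fin (m + 2)) ≠ 1 := by
        intro i h; simp [Fin.ext_iff] at h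
      simp [Fin.succ_ne_zero, this]
      rw [← add_div, ← mul_add, hpq]
      field_simp
      rfl)
  apply lkF_conj _ _ _ _ _ _ hAB
  let d : Fin (m + 2) → K := fun i => if i = 0 then 1 + ε else 1
  let e : Fin (m + 2) → K := fun i => ((i : ℕ) : K)
  let lam : Fin (m + 2) → Fin (m + 2) → K := fun i j =>
    e i * (k1 * d i + k2 * d j + l3 * d i) + e j * (k3 * d j + l1 * d i + l2 * d j)
  have he0 : ∀ i, i ≠ 0 → e i ≠ 0 := by
    intro i hi; simp [e, hi]
  have hlam : ∀ i j, i ≠ j → lam i j ≠ 0 := by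
    intro i j hij
    by_cases hi : i = 0
    · have hj : j ≠ 0 := fun h => hij (hi.trans h.symm)
      have : lam i j = e j * (-κ + l1 * ε) := by
        simp only [lam, d, hi, hj, if_true, if_false, e]
        simp
        left
        linear_combination hsum
      rw [this]
      exact mul_ne_zero (he0 j hj) hl1
    · by_cases hj : j = 0
      · have : lam i j = e i * (κ + k2 * ε) := by
          simp only [lam, d, hi, hj, if_true, if_false, e]
          simp
          left
          ring
        rw [this]
        exact mul_ne_zero (he0 i hi) hk2
      · have : lam i j = κ * (e i - e j) := by
          simp only [lam, d, hi, hj, if_false]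
          linear_combination e j * hsum
        rw [this]
        refine mul_ne_zero hκ ?_
        rw [sub_ne_zero]
        intro h
        apply hij
        simp only [e] at h
        exact Fin.ext (Nat.cast_injective h)
  have h10 : (1 : Fin (m + 2)) ≠ 0 := by simp
  have hl10 := hlam 1 0 h10
  let s : K := τ * lam 1 0 / (γ * ε * B 1 0)
  let z0 : Matrix (Fin (m + 2)) (Fin (m + 2)) K := Matrix.of fun i j =>
    if i = j then 0 else B i j / lam i j
  let T : Fin (m + 2) → Fin (m + 2) → K := fun i j =>
      (if i = 0 then s * z0 1 j * (k1 * d 0 + k2 * d j + l3 * d 1) else 0) +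
      (if j = 1 then s * z0 i 0 * (k3 * d 0 + l1 * d i + l2 * d 1) else 0)
  let z : Matrix (Fin (m + 2)) (Fin (m + 2)) K := Matrix.of fun i j =>
    if i = j then 0 else (B i j - T i j) / lam i j
  have hz1 : ∀ j, z 1 j = z0 1 j := by
    intro j
    simp only [z, z0, Matrix.of_apply]
    by_cases h : 1 = j
    · simp [h]
    · simp [h, T, Ne.symm h]
  have hz2 : ∀ i, z i 0 = z0 i 0 := by
    intro i
    simp only [z, z0, Matrix.of_apply]
    by_cases h : i = 0
    · simp [h]
    · simp [h, T]
  refine ⟨diagonal d, diagonal e + single 0 1 s, z, ?_⟩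
  ext i j
  rw [lkF_add_mid, Matrix.add_apply, lkF_diag, lkF_single, hz1, hz2]
  change B i j = lam i j * z i j + T i j
  by_cases hij : i = j
  · subst hij
    have hz : z i i = 0 := by simp [z]
    have hz10 : z0 1 0 = B 1 0 / lam 1 0 := by simp [z0]
    have hs : s * z0 1 0 = τ / (γ * ε) := by
      rw [hz10]; simp only [s]; field_simp
    rw [hz, hBd, mul_zero, zero_add]
    simp only [T]
    by_cases h0 : i = 0
    · subst h0
      simp only [if_true, h10.symm, if_false, add_zero, hs, d, h10]
      rw [hp, hκd]; ring
    · by_cases h1 : i = 1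
      · subst h1
        simp only [if_true, h10, if_false, zero_add, hs, d]
        rw [hq]
        field_simp
        linear_combination (-τ) * hsum
      · simp [h0, h1]
  · have hl := hlam i j hij
    simp only [z, Matrix.of_apply, hij, if_false]
    field_simp
    ring

/-- The clock and shift matrices. -/
theorem lk_clock {K : Type*} [Field K] [IsAlgClosed K] [CharZero K] (m : ℕ) :
    ∃ (ω : K) (P P' Q Q' : Matrix (Fin (m + 2)) (Fin (m + 2)) K), ω ≠ 1 ∧
      P * P' = 1 ∧ P' * P = 1 ∧ Q * Q' = 1 ∧ Q' * Q = 1 ∧ P * Q = ω • (Q * P) := by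
  obtain ⟨ω, hω⟩ := HasEnoughRootsOfUnity.exists_primitiveRoot K (m + 2)
  have hω0 : ω ≠ 0 := hω.ne_zero (by simp)
  let P : Matrix (Fin (m + 2)) (Fin (m + 2)) K := Matrix.of fun i j => if i + 1 = j then 1 else 0
  have h1 : P * Pᵀ = 1 := by
    ext i j
    simp [P, Matrix.mul_apply, Matrix.one_apply, eq_comm]
  refine ⟨ω, P, Pᵀ, diagonal fun i => ω ^ (i : ℕ), diagonal fun i => (ω ^ (i : ℕ))⁻¹,
    hω.ne_one (by omega), h1, mul_eq_one_comm.mp h1, ?_, ?_, ?_⟩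
  · rw [diagonal_mul_diagonal, ← diagonal_one]
    congr 1; ext i; exact mul_inv_cancel₀ (pow_ne_zero _ hω0)
  · rw [diagonal_mul_diagonal, ← diagonal_one]
    congr 1; ext i; exact inv_mul_cancel₀ (pow_ne_zero _ hω0)
  · ext i j
    simp only [mul_diagonal, Matrix.smul_apply, diagonal_mul, P, Matrix.of_apply, smul_eq_mul]
    split_ifs with h
    · subst h
      rw [Fin.val_add, ← pow_eq_pow_mod _ hω.pow_eq_one]
      simp [pow_succ, mul_comm]
    · simp

theorem lk_scalar {K : Type*} [Field K] [IsAlgClosed K] [CharZero K] (m : ℕ)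
    (k1 k2 k3 l1 l2 l3 : K) (hsum : k1 + k2 + k3 + l1 + l2 + l3 = 0) (hγ : k1 + k2 + k3 ≠ 0)
    (r : K) : ∃ x y z : Matrix (Fin (m + 2)) (Fin (m + 2)) K,
      r • (1 : Matrix (Fin (m + 2)) (Fin (m + 2)) K) = lkF k1 k2 k3 l1 l2 l3 x y z := by
  obtain ⟨ω, P, P', Q, Q', hω, h1, h2, h3, h4, h5⟩ := lk_clock (K := K) m
  have h6 : Q * P' = ω • (P' * Q) := by
    calc Q * P' = (P' * P) * Q * P' := by rw [h2, Matrix.one_mul]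
      _ = P' * (P * Q) * P' := by simp only [Matrix.mul_assoc]
      _ = ω • (P' * Q * (P * P')) := by
        rw [h5]; simp only [Matrix.mul_smul, Matrix.smul_mul, Matrix.mul_assoc]
      _ = _ := by rw [h1, Matrix.mul_one]
  have e1 : Q * P * (P' * Q') = 1 := by
    rw [Matrix.mul_assoc, ← Matrix.mul_assoc P, h1, Matrix.one_mul, h3]
  have e2 : P * (P' * Q') * Q = 1 := by
    rw [← Matrix.mul_assoc P, h1, Matrix.one_mul, h4]
  have e3 : (P' * Q') * Q * P = 1 := by
    rw [Matrix.mul_assoc P', h4, Matrix.mul_one, h2]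
  have e4 : Q * (P' * Q') * P = ω • 1 := by
    rw [← Matrix.mul_assoc Q, h6, Matrix.smul_mul, Matrix.mul_assoc P', h3, Matrix.mul_one,
      Matrix.smul_mul, h2]
  have e5 : (P' * Q') * P * Q = ω • 1 := by
    rw [Matrix.mul_assoc _ P, h5, Matrix.mul_smul, ← Matrix.mul_assoc, e3]
  have e6 : P * Q * (P' * Q') = ω • 1 := by
    rw [h5, Matrix.smul_mul, e1]
  have hg : (k1 + k2 + k3) * (1 - ω) ≠ 0 := mul_ne_zero hγ (sub_ne_zero.mpr hω.symm)
  refine ⟨Q, P, (r / ((k1 + k2 + k3) * (1 - ω))) • (P' * Q'), ?_⟩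
  rw [lkF_smul]
  have : lkF k1 k2 k3 l1 l2 l3 Q P (P' * Q') =
      ((k1 + k2 + k3) * (1 - ω)) • (1 : Matrix (Fin (m + 2)) (Fin (m + 2)) K) := by
    simp only [lkF, e1, e2, e3, e4, e5, e6, smul_smul, ← add_smul]
    congr 1
    linear_combination ω * hsum
  rw [this, smul_smul, div_mul_cancel₀ _ hg]

theorem lk_zerodiag {K : Type*} [Field K] [CharZero K] (m : ℕ)
    (S : Matrix (Fin (m + 2)) (Fin (m + 2)) K → Prop)
    (hS : ∀ A B, IsConj A B → S B → S A) (h0 : ∀ A, (∀ i, A i i = 0) → S A)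
    (A : Matrix (Fin (m + 2)) (Fin (m + 2)) K) (hA : A.trace = 0) : S A := by
  by_cases h : ∀ r : K, A ≠ r • 1
  · obtain ⟨B, hAB, hB, -⟩ := lk_fillmore m A h (fun _ => 0) (by simp [hA])
    exact hS A B hAB (h0 B hB)
  · push Not at h
    obtain ⟨r, rfl⟩ := h
    have hr : r = 0 := by
      rw [Matrix.trace_smul, Matrix.trace_one] at hA
      simp only [smul_eq_mul, mul_eq_zero, Nat.cast_eq_zero, Fintype.card_fin] at hA
      rcases hA with h | h
      · exact h
      · omega
    apply h0
    simp [hr]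

/-- The set of values. -/
def lkIm {K : Type*} [Field K] (n : ℕ) (k1 k2 k3 l1 l2 l3 : K) :
    Set (Matrix (Fin n) (Fin n) K) :=
  {A | ∃ x y z, A = lkF k1 k2 k3 l1 l2 l3 x y z}

theorem lkIm_rot {K : Type*} [Field K] (n : ℕ) (k1 k2 k3 l1 l2 l3 : K) :
    lkIm n k3 k1 k2 l2 l3 l1 = lkIm n k1 k2 k3 l1 l2 l3 := by
  ext A
  constructor
  · rintro ⟨x, y, z, h⟩
    exact ⟨y, z, x, by rw [h, lkF_rot]⟩
  · rintro ⟨x, y, z, h⟩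
    exact ⟨z, x, y, by rw [h, lkF_rot k1 k2 k3 l1 l2 l3 z x y]⟩

theorem lk_full {K : Type*} [Field K] [IsAlgClosed K] [CharZero K] (m : ℕ)
    (k1 k2 k3 l1 l2 l3 : K) (hsum : k1 + k2 + k3 + l1 + l2 + l3 = 0) (hγ : k1 + k2 + k3 ≠ 0)
    (hκ : k1 + k2 + l3 ≠ 0) : lkIm (m + 2) k1 k2 k3 l1 l2 l3 = Set.univ := by
  apply Set.eq_univ_of_forall
  intro A
  by_cases h : ∀ r : K, A ≠ r • 1
  · exact lk_nonscalar m _ _ _ _ _ _ hsum hγ hκ A h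
  · push Not at h
    obtain ⟨r, rfl⟩ := h
    exact lk_scalar m _ _ _ _ _ _ hsum hγ r

theorem lk_sl_of_kappa {K : Type*} [Field K] [CharZero K] (m : ℕ)
    (k1 k2 k3 l1 l2 l3 : K) (hsum : k1 + k2 + k3 + l1 + l2 + l3 = 0)
    (hκ : k1 + k2 + l3 ≠ 0) (A : Matrix (Fin (m + 2)) (Fin (m + 2)) K) (hA : A.trace = 0) :
    A ∈ lkIm (m + 2) k1 k2 k3 l1 l2 l3 := by
  refine lk_zerodiag m (fun A => A ∈ lkIm (m + 2) k1 k2 k3 l1 l2 l3)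
    (fun A B h hB => lkF_conj _ _ _ _ _ _ h hB) ?_ A hA
  intro A hA
  refine ⟨diagonal fun _ => 1, diagonal fun i => ((i : ℕ) : K),
    Matrix.of fun i j => A i j / ((k1 + k2 + l3) * (((i : ℕ) : K) - ((j : ℕ) : K))), ?_⟩
  ext i j
  rw [lkF_diag]
  by_cases hij : i = j
  · subst hij; simp [hA]
  · have : ((i : ℕ) : K) - ((j : ℕ) : K) ≠ 0 := by
      rw [sub_ne_zero]
      intro h
      exact hij (Fin.ext (Nat.cast_injective h))
    simp only [Matrix.of_apply]
    field_simp
    linear_combination (-(A i j * ((j : ℕ) : K))) * hsum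

theorem lk_sl_of_lie {K : Type*} [Field K] [CharZero K] (m : ℕ)
    (k1 k2 k3 l1 l2 l3 : K) (hγ : k1 + k2 + k3 = 0) (h1 : l1 = k2) (h2 : l2 = k1) (h3 : l3 = k3)
    (hk : k2 ≠ 0) (A : Matrix (Fin (m + 2)) (Fin (m + 2)) K) (hA : A.trace = 0) :
    A ∈ lkIm (m + 2) k1 k2 k3 l1 l2 l3 := by
  refine lk_zerodiag m (fun A => A ∈ lkIm (m + 2) k1 k2 k3 l1 l2 l3)
    (fun A B h hB => lkF_conj _ _ _ _ _ _ h hB) ?_ A hA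
  intro A hA
  refine ⟨diagonal fun i => ((i : ℕ) : K), diagonal fun i => ((i : ℕ) : K),
    Matrix.of fun i j => A i j / (-k2 * (((i : ℕ) : K) - ((j : ℕ) : K)) ^ 2), ?_⟩
  ext i j
  rw [lkF_diag]
  by_cases hij : i = j
  · subst hij; simp [hA]
  · have : ((i : ℕ) : K) - ((j : ℕ) : K) ≠ 0 := by
      rw [sub_ne_zero]
      intro h
      exact hij (Fin.ext (Nat.cast_injective h))
    simp only [Matrix.of_apply]
    have hk3 : k3 = -k1 - k2 := by linear_combination hγ
    subst h1 h2 h3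
    rw [hk3]
    field_simp
    ring

theorem lk_three {K : Type*} [Field K] [IsAlgClosed K] [CharZero K] (m : ℕ)
    (k1 k2 k3 l1 l2 l3 : K) :
    ∃ V : Submodule K (Matrix (Fin (m + 2)) (Fin (m + 2)) K),
      lkIm (m + 2) k1 k2 k3 l1 l2 l3 = (V : Set _) := by
  by_cases hsum : k1 + k2 + k3 + l1 + l2 + l3 = 0
  swap
  · refine ⟨⊤, ?_⟩
    rw [Submodule.top_coe]
    apply Set.eq_univ_of_forall
    intro A
    refine ⟨1, 1, (k1 + k2 + k3 + l1 + l2 + l3)⁻¹ • A, ?_⟩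
    rw [lkF_smul]
    simp only [lkF, Matrix.one_mul, Matrix.mul_one, ← add_smul, smul_smul]
    rw [inv_mul_cancel₀ hsum, one_smul]
  have hsum2 : k3 + k1 + k2 + l2 + l3 + l1 = 0 := by linear_combination hsum
  have hsum3 : k2 + k3 + k1 + l3 + l1 + l2 = 0 := by linear_combination hsum
  have r1 := lkIm_rot (m + 2) k1 k2 k3 l1 l2 l3
  have r2 := lkIm_rot (m + 2) k3 k1 k2 l2 l3 l1
  by_cases hγ : k1 + k2 + k3 = 0
  swap
  · refine ⟨⊤, ?_⟩
    rw [Submodule.top_coe]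
    by_cases hκ1 : k1 + k2 + l3 = 0
    · by_cases hκ2 : k3 + k1 + l1 = 0
      · have hκ3 : k2 + k3 + l2 ≠ 0 := by
          intro h
          apply hγ
          linear_combination hκ1 + hκ2 + h - hsum
        rw [← r1, ← r2]
        exact lk_full m _ _ _ _ _ _ hsum3 (fun h => hγ (by linear_combination h)) hκ3
      · rw [← r1]
        exact lk_full m _ _ _ _ _ _ hsum2 (fun h => hγ (by linear_combination h)) hκ2
    · exact lk_full m _ _ _ _ _ _ hsum hγ hκ1
  have htr : ∀ A ∈ lkIm (m + 2) k1 k2 k3 l1 l2 l3, A.trace = 0 := by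
    rintro A ⟨x, y, z, rfl⟩
    simp only [lkF, Matrix.trace_add, Matrix.trace_smul, smul_eq_mul]
    have t1 : (y * z * x).trace = (x * y * z).trace := by
      rw [Matrix.trace_mul_comm, Matrix.mul_assoc]
    have t2 : (z * x * y).trace = (x * y * z).trace := by
      rw [Matrix.mul_assoc, Matrix.trace_mul_comm]
    have t3 : (z * y * x).trace = (x * z * y).trace := by
      rw [Matrix.trace_mul_comm, Matrix.mul_assoc]
    have t4 : (y * x * z).trace = (x * z * y).trace := by
      rw [Matrix.mul_assoc, Matrix.trace_mul_comm]
    rw [t1, t2, t3, t4]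
    linear_combination ((x * y * z).trace - (x * z * y).trace) * hγ + (x * z * y).trace * hsum
  by_cases hF : (k1 = 0 ∧ k2 = 0 ∧ k3 = 0) ∧ l1 = 0 ∧ l2 = 0 ∧ l3 = 0
  · obtain ⟨⟨rfl, rfl, rfl⟩, rfl, rfl, rfl⟩ := hF
    refine ⟨⊥, ?_⟩
    ext A
    simp [lkIm, lkF]
  refine ⟨LinearMap.ker (Matrix.traceLinearMap (Fin (m + 2)) K K), ?_⟩
  ext A
  constructor
  · intro h
    simpa using htr A h
  intro h
  have hA : A.trace = 0 := by simpa using h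
  by_cases hκ1 : k1 + k2 + l3 = 0
  swap
  · exact lk_sl_of_kappa m _ _ _ _ _ _ hsum hκ1 A hA
  by_cases hκ2 : k3 + k1 + l1 = 0
  swap
  · rw [← r1]; exact lk_sl_of_kappa m _ _ _ _ _ _ hsum2 hκ2 A hA
  by_cases hκ3 : k2 + k3 + l2 = 0
  swap
  · rw [← r1, ← r2]; exact lk_sl_of_kappa m _ _ _ _ _ _ hsum3 hκ3 A hA
  have e1 : l1 = k2 := by linear_combination hκ2 - hγ
  have e2 : l2 = k1 := by linear_combination hκ3 - hγ
  have e3 : l3 = k3 := by linear_combination hκ1 - hγ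
  by_cases z2 : k2 = 0
  swap
  · exact lk_sl_of_lie m _ _ _ _ _ _ hγ e1 e2 e3 z2 A hA
  by_cases z1 : k1 = 0
  swap
  · rw [← r1]
    exact lk_sl_of_lie m _ _ _ _ _ _ (by linear_combination hγ) e2 e3 e1 z1 A hA
  · exfalso
    apply hF
    have z3 : k3 = 0 := by linear_combination hγ - z1 - z2
    exact ⟨⟨z1, z2, z3⟩, e1.trans z2, e2.trans z1, e3.trans z3⟩

theorem lk_two {K : Type*} [Field K] [CharZero K] (m : ℕ) (a b : K) :
    ∃ V : Submodule K (Matrix (Fin (m + 2)) (Fin (m + 2)) K),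
      {A : Matrix (Fin (m + 2)) (Fin (m + 2)) K | ∃ x y, A = a • (x * y) + b • (y * x)} = (V : Set _) := by
  by_cases hs : a + b = 0
  swap
  · refine ⟨⊤, ?_⟩
    rw [Submodule.top_coe]
    apply Set.eq_univ_of_forall
    intro A
    refine ⟨1, (a + b)⁻¹ • A, ?_⟩
    rw [Matrix.one_mul, Matrix.mul_one, ← add_smul, smul_smul, mul_inv_cancel₀ hs, one_smul]
  have hb : b = -a := by linear_combination hs
  by_cases ha : a = 0
  · refine ⟨⊥, ?_⟩
    ext A
    simp [hb, ha]
  refine ⟨LinearMap.ker (Matrix.traceLinearMap (Fin (m + 2)) K K), ?_⟩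
  ext A
  constructor
  · rintro ⟨x, y, rfl⟩
    simp [hb, Matrix.trace_mul_comm x y]
  intro h
  have hA : A.trace = 0 := by simpa using h
  obtain ⟨x, y, z, hx⟩ := lk_sl_of_kappa m a 0 b 0 0 0 (by simpa using hs) (by simpa using ha) A hA
  refine ⟨x * y, z, ?_⟩
  rw [hx]
  simp [lkF, Matrix.mul_assoc]

end LKThree

/-- Theorem of Vitas (the L'vov–Kaplansky conjecture for polynomials of degree at most
3): if `K` is an algebraically closed field of characteristic 0 and `f` is a multilinear
polynomial of degree `d ≤ 3`, then `f(Mₙ(K))` is a `K`-linear subspace for every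
`n ≥ 2`. -/
theorem lvov_kaplansky_degree_le_three
    (K : Type*) [Field K] [IsAlgClosed K] [CharZero K]
    (d : ℕ) (hd1 : 1 ≤ d) (hd3 : d ≤ 3) (c : Equiv.Perm (Fin d) → K)
    (n : ℕ) (hn : 2 ≤ n) :
    ∃ V : Submodule K (Matrix (Fin n) (Fin n) K),
      {x : Matrix (Fin n) (Fin n) K |
        ∃ a : Fin d → Matrix (Fin n) (Fin n) K, x = mlinEval c a} = (V : Set _) := by
  obtain ⟨m, rfl⟩ : ∃ m, n = m + 2 := ⟨n - 2, by omega⟩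
  interval_cases d
  · by_cases h : c 1 = 0
    · refine ⟨⊥, ?_⟩
      ext A
      have : ∀ σ : Equiv.Perm (Fin 1), c σ = 0 := by
        intro σ; rw [Subsingleton.elim σ 1, h]
      simp [mlinEval, this]
    · refine ⟨⊤, ?_⟩
      rw [Submodule.top_coe]
      apply Set.eq_univ_of_forall
      intro A
      refine ⟨fun _ => (c 1)⁻¹ • A, ?_⟩
      rw [mlinEval, Fintype.sum_unique]
      rw [Subsingleton.elim default (1 : Equiv.Perm (Fin 1))]
      simp [smul_smul, h]
  · obtain ⟨V, hV⟩ := lk_two m (c 1) (c (Equiv.swap 0 1))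
    refine ⟨V, ?_⟩
    rw [← hV]
    have hu : (Finset.univ : Finset (Equiv.Perm (Fin 2))) = {1, Equiv.swap 0 1} := by decide
    have hev : ∀ a : Fin 2 → Matrix (Fin (m + 2)) (Fin (m + 2)) K,
        mlinEval c a = c 1 • (a 0 * a 1) + c (Equiv.swap 0 1) • (a 1 * a 0) := by
      intro a
      rw [mlinEval, hu, Finset.sum_pair (by decide)]
      simp [List.ofFn_succ]
    ext A
    constructor
    · rintro ⟨a, h⟩
      exact ⟨a 0, a 1, by rw [h, hev]⟩
    · rintro ⟨x, y, h⟩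
      exact ⟨![x, y], by rw [h, hev]; rfl⟩
  · obtain ⟨V, hV⟩ := lk_three m (c 1) (c (Equiv.swap 0 1 * Equiv.swap 1 2))
      (c (Equiv.swap 1 2 * Equiv.swap 0 1))
      (c (Equiv.swap 1 2)) (c (Equiv.swap 0 2)) (c (Equiv.swap 0 1))
    refine ⟨V, ?_⟩
    rw [← hV]
    have hu : (Finset.univ : Finset (Equiv.Perm (Fin 3))) =
        {1, Equiv.swap 0 1 * Equiv.swap 1 2, Equiv.swap 1 2 * Equiv.swap 0 1,
          Equiv.swap 1 2, Equiv.swap 0 2, Equiv.swap 0 1} := by decide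
    have hev : ∀ a : Fin 3 → Matrix (Fin (m + 2)) (Fin (m + 2)) K,
        mlinEval c a = lkF (c 1) (c (Equiv.swap 0 1 * Equiv.swap 1 2))
          (c (Equiv.swap 1 2 * Equiv.swap 0 1))
          (c (Equiv.swap 1 2)) (c (Equiv.swap 0 2)) (c (Equiv.swap 0 1)) (a 0) (a 1) (a 2) := by
      intro a
      have hl : ∀ σ : Equiv.Perm (Fin 3),
          (List.ofFn fun i => a (σ i)).prod = a (σ 0) * a (σ 1) * a (σ 2) := by
        intro σ; simp [List.ofFn_succ, mul_assoc]
      rw [mlinEval, hu]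
      rw [Finset.sum_insert (by decide), Finset.sum_insert (by decide),
        Finset.sum_insert (by decide), Finset.sum_insert (by decide),
        Finset.sum_insert (by decide), Finset.sum_singleton]
      simp only [hl]
      unfold lkF
      simp only [add_assoc]
      rfl
    ext A
    constructor
    · rintro ⟨a, h⟩
      exact ⟨a 0, a 1, a 2, by rw [h, hev]⟩
    · rintro ⟨x, y, z, h⟩
      exact ⟨![x, y, z], by rw [h, hev]; rfl⟩
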